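/- arXiv:2211.09482 — 2 statements merged into one kernel-verified Lean document; each statement's English description precedes it below -/
import Mathlib

section
/- There is a universal constant C > 0 such that the following holds. Let X be a 3-dimensional λ-local spectral expander and 0 < η < 1. For any set of triangles A ⊆ X(2) with ‖A‖ ≤ η/2, the set S₀' = {v ∈ X(0) : ‖A^v‖ ≤ η} satisfies ‖S₀'‖ ≥ 1 − C·(λ/η²)·‖A‖, where A^v = A ∩ X_v(2) is the restriction of A to the link of v, with weight measured in X_v. -/
/- Common framework: weighted simplicial complexes, links, localizations,
   local spectral expansion, cochains, coboundaries, minimality, etc. -/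

open Finset

open scoped Classical

namespace HDX

variable {V : Type*} [Fintype V] [DecidableEq V]

/-- The faces of cardinality `m` of a family of finite sets.  (A `k`-dimensional face
has cardinality `k+1`; the `(-1)`-face is the empty set, of cardinality `0`.) -/
def facesCard (Y : Finset (Finset V)) (m : ℕ) : Finset (Finset V) :=
  Y.filter fun s => s.card = m

/-- A simplicial complex: a downwards-closed family of finite sets. -/
def IsComplex (Y : Finset (Finset V)) : Prop :=
  ∀ σ ∈ Y, ∀ τ ⊆ σ, τ ∈ Y

/-- A (pure) `d`-dimensional complex: nonempty, all faces have at most `d+1` vertices, and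
every face is contained in a face with exactly `d+1` vertices (a top face). -/
def IsPureDim (Y : Finset (Finset V)) (d : ℕ) : Prop :=
  Y.Nonempty ∧ (∀ σ ∈ Y, σ.card ≤ d + 1) ∧ ∀ σ ∈ Y, ∃ τ ∈ Y, σ ⊆ τ ∧ τ.card = d + 1

/-- The weight `‖A‖` of a family `A` of faces of cardinality `m`, in a complex whose top
faces have cardinality `t`: pick a top face uniformly at random, then a uniformly random
subset of cardinality `m` of it, and take the probability that it lies in `A`. -/
noncomputable def wt (Y : Finset (Finset V)) (t m : ℕ) (A : Finset (Finset V)) : ℝ :=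
  (∑ σ ∈ facesCard Y t, (((σ.powersetCard m).filter (· ∈ A)).card : ℝ)) /
    (((facesCard Y t).card : ℝ) * (t.choose m : ℝ))

/-- The mutual weight `‖(A,B)‖` of `A` (faces of cardinality `m`) and `B` (faces of
cardinality `l`, `l ≤ m`): the probability that a random `m`-subset of a random top face is
in `A` and a further uniformly random `l`-subset of it is in `B`. -/
noncomputable def mwt (Y : Finset (Finset V)) (t m l : ℕ) (A B : Finset (Finset V)) : ℝ :=
  (∑ σ ∈ facesCard Y t, ∑ τ ∈ (σ.powersetCard m).filter (· ∈ A),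
      (((τ.powersetCard l).filter (· ∈ B)).card : ℝ)) /
    (((facesCard Y t).card : ℝ) * (t.choose m : ℝ) * (m.choose l : ℝ))

/-- Localization of a family `A` to (the link of) a face `σ`:
`A_σ = {τ \ σ | σ ⊆ τ ∈ A}`. -/
def localize (A : Finset (Finset V)) (σ : Finset V) : Finset (Finset V) :=
  (A.filter fun τ => σ ⊆ τ).image fun τ => τ \ σ

/-- The link `X_σ = {τ \ σ | σ ⊆ τ ∈ X}` of a face `σ`. -/
def link (Y : Finset (Finset V)) (σ : Finset V) : Finset (Finset V) :=
  localize Y σ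

/-- `locWt Y t A m σ` is the weight `‖A_σ‖` of the localization to the link of `σ` of the
family `A` of faces of cardinality `m`, where `Y` has top faces of cardinality `t`. -/
noncomputable def locWt (Y : Finset (Finset V)) (t : ℕ) (A : Finset (Finset V)) (m : ℕ)
    (σ : Finset V) : ℝ :=
  wt (link Y σ) (t - σ.card) (m - σ.card) (localize A σ)

/-- `w` is (the weight function of) a weighted graph which is a `λ`-spectral expander:
for every function orthogonal to the constants (in the weighted inner product) the Rayleigh
quotient of the normalized adjacency operator is at most `λ` in absolute value. -/
def IsSpectralExpanderW (w : V → V → ℝ) (lam : ℝ) : Prop :=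
  ∀ f : V → ℝ, (∑ u, (∑ v, w u v) * f u) = 0 →
    |∑ u, ∑ v, w u v * f u * f v| ≤ lam * ∑ u, (∑ v, w u v) * f u ^ 2

/-- The weight of the edge `{u,v}` in the underlying weighted graph of a complex with top
faces of cardinality `t`. -/
noncomputable def edgeWt (Y : Finset (Finset V)) (t : ℕ) (u v : V) : ℝ :=
  if u ≠ v then wt Y t 2 {({u, v} : Finset V)} else 0

/-- `λ`-local spectral expander: the underlying weighted graph of the link of every face of
dimension at most `d-2` (including the empty face) is a `λ`-spectral expander. -/
def IsLocalSpectralExpander (Y : Finset (Finset V)) (d : ℕ) (lam : ℝ) : Prop :=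
  ∀ σ ∈ Y, σ.card + 2 ≤ d + 1 →
    IsSpectralExpanderW (edgeWt (link Y σ) (d + 1 - σ.card)) lam

/-- `q`-bounded degree: every vertex is contained in at most `q` top faces. -/
def IsBoundedDegree (Y : Finset (Finset V)) (d q : ℕ) : Prop :=
  ∀ v : V, ((facesCard Y (d + 1)).filter fun σ => v ∈ σ).card ≤ q

/-- The skeleton consisting of the faces with at most `m` vertices
(i.e. of dimension at most `m - 1`). -/
def skeleton (Y : Finset (Finset V)) (m : ℕ) : Finset (Finset V) :=
  Y.filter fun σ => σ.card ≤ m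

/-- `δ₁(A)`: the faces of cardinality `m+1` that contain exactly one member of `A`
(a family of faces of cardinality `m`). -/
def delta1 (Y : Finset (Finset V)) (m : ℕ) (A : Finset (Finset V)) : Finset (Finset V) :=
  (facesCard Y (m + 1)).filter fun τ => ((τ.powersetCard m).filter (· ∈ A)).card = 1

/-- For `A ⊆ X(k)`, the set `S_{k-1}` of `(k-1)`-faces `σ` with `‖A_σ‖ ≤ η`. -/
noncomputable def nonlocalS (Y : Finset (Finset V)) (t k : ℕ) (A : Finset (Finset V))
    (η : ℝ) : Finset (Finset V) :=
  (facesCard Y k).filter fun σ => locWt Y t A (k + 1) σ ≤ η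

/-- `A ⊆ X(k)` is `(η,ε)`-non-local if `‖(A, S_{k-1})‖ ≥ (1-ε)‖A‖`. -/
def IsNonlocal (Y : Finset (Finset V)) (t k : ℕ) (A : Finset (Finset V)) (η ε : ℝ) : Prop :=
  mwt Y t (k + 1) k A (nonlocalS Y t k A η) ≥ (1 - ε) * wt Y t (k + 1) A

/-- For `A ⊆ X(k)`, the set `S_{k-2}` of `(k-2)`-faces `σ` with `‖A_σ‖ ≤ η`. -/
noncomputable def weakS (Y : Finset (Finset V)) (t k : ℕ) (A : Finset (Finset V))
    (η : ℝ) : Finset (Finset V) :=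
  (facesCard Y (k - 1)).filter fun σ => locWt Y t A (k + 1) σ ≤ η

/-- `A ⊆ X(k)` is `(η,ε,α)`-weakly-non-local if `‖S_{k-2}‖ ≥ 1 - ε‖A‖` and `‖A_τ‖ ≤ 1-α`
for every `(k-1)`-face `τ`. -/
def IsWeaklyNonlocal (Y : Finset (Finset V)) (t k : ℕ) (A : Finset (Finset V))
    (η ε α : ℝ) : Prop :=
  wt Y t (k - 1) (weakS Y t k A η) ≥ 1 - ε * wt Y t (k + 1) A ∧
    ∀ τ ∈ facesCard Y k, locWt Y t A (k + 1) τ ≤ 1 - α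

section Abelian

variable {G : Type*} [AddCommGroup G]

/-- An ordered face of the complex: an injective tuple whose image is a face. -/
def IsFaceTup (Y : Finset (Finset V)) {m : ℕ} (tup : Fin m → V) : Prop :=
  Function.Injective tup ∧ Finset.image tup Finset.univ ∈ Y

/-- A cochain over an abelian group `G` on the faces with `m` vertices (i.e. an
`(m-1)`-dimensional cochain): an antisymmetric `G`-valued function on ordered faces,
vanishing on tuples which are not ordered faces. -/
def IsCochain (Y : Finset (Finset V)) {m : ℕ} (f : (Fin m → V) → G) : Prop :=
  (∀ (tup : Fin m → V) (π : Equiv.Perm (Fin m)),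
      f (tup ∘ π) = ((Equiv.Perm.sign π : ℤˣ) : ℤ) • f tup) ∧
    ∀ tup : Fin m → V, ¬IsFaceTup Y tup → f tup = 0

/-- The coboundary operator `δ(f)(v_0,…,v_m) = ∑ i, (-1)^i f(v_0,…,v_{i-1},v_{i+1},…,v_m)`. -/
def cob {m : ℕ} (f : (Fin m → V) → G) : (Fin (m + 1) → V) → G := fun tup =>
  ∑ i : Fin (m + 1), ((-1 : ℤ) ^ (i : ℕ)) • f (tup ∘ i.succAbove)

/-- The support of `f`: the faces (with `m` vertices) on which `f` does not vanish. -/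
noncomputable def suppC (Y : Finset (Finset V)) {m : ℕ} (f : (Fin m → V) → G) :
    Finset (Finset V) :=
  (facesCard Y m).filter fun σ =>
    ∃ tup : Fin m → V, Finset.image tup Finset.univ = σ ∧ f tup ≠ 0

/-- The norm `‖f‖` of a cochain: the weight of its support. -/
noncomputable def normC (Y : Finset (Finset V)) (t : ℕ) {m : ℕ} (f : (Fin m → V) → G) : ℝ :=
  wt Y t m (suppC Y f)

/-- A cocycle: a cochain whose coboundary vanishes on all (ordered) faces. -/
def IsCocycle (Y : Finset (Finset V)) {m : ℕ} (f : (Fin m → V) → G) : Prop :=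
  IsCochain Y f ∧ ∀ tup : Fin (m + 1) → V, IsFaceTup Y tup → cob f tup = 0

/-- A coboundary: a function agreeing on all ordered faces with the coboundary of a cochain
of one dimension below. -/
def IsCoboundaryFn (Y : Finset (Finset V)) {m : ℕ} (f : (Fin (m + 1) → V) → G) : Prop :=
  ∃ g : (Fin m → V) → G, IsCochain Y g ∧
    ∀ tup : Fin (m + 1) → V, IsFaceTup Y tup → f tup = cob g tup

/-- The distance of `f` from the coboundaries. -/
noncomputable def distB (Y : Finset (Finset V)) (t : ℕ) {m : ℕ}
    (f : (Fin (m + 1) → V) → G) : ℝ :=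
  sInf {r : ℝ | ∃ g : (Fin m → V) → G, IsCochain Y g ∧
    r = normC Y t fun tup => f tup - cob g tup}

/-- The distance of `f` from the cocycles. -/
noncomputable def distZ (Y : Finset (Finset V)) (t : ℕ) {m : ℕ}
    (f : (Fin m → V) → G) : ℝ :=
  sInf {r : ℝ | ∃ g : (Fin m → V) → G, IsCocycle Y g ∧
    r = normC Y t fun tup => f tup - g tup}

/-- A minimal cochain: its weight cannot be decreased by adding a coboundary. -/
def IsMinimal (Y : Finset (Finset V)) (t : ℕ) {m : ℕ} (f : (Fin (m + 1) → V) → G) : Prop :=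
  ∀ g : (Fin m → V) → G, IsCochain Y g →
    normC Y t f ≤ normC Y t fun tup => f tup - cob g tup

/-- The localization `f_v` of a cochain to the link of a vertex `v`: `f_v(τ) = f(vτ)`. -/
def localizeC {m : ℕ} (f : (Fin (m + 1) → V) → G) (v : V) : (Fin m → V) → G :=
  fun tup => f (Fin.cons v tup)

/-- A locally minimal cochain: all its localizations to links of vertices are minimal. -/
def IsLocallyMinimal (Y : Finset (Finset V)) (t : ℕ) {m : ℕ}
    (f : (Fin (m + 2) → V) → G) : Prop :=
  ∀ v : V, ({v} : Finset V) ∈ Y → IsMinimal (link Y {v}) (t - 1) (localizeC f v)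

/-- A `β`-coboundary expander over `G` (for a complex with top faces of cardinality `t`):
for every dimension below the dimension of the complex, every cochain which is not a
coboundary satisfies `‖δ(f)‖ ≥ β · dist(f, B)`. -/
def IsCoboundaryExpander (Y : Finset (Finset V)) (t : ℕ) (G : Type*) [AddCommGroup G]
    (β : ℝ) : Prop :=
  ∀ m : ℕ, m + 2 ≤ t → ∀ f : (Fin (m + 1) → V) → G, IsCochain Y f → ¬IsCoboundaryFn Y f →
    normC Y t (cob f) ≥ β * distB Y t f

/-- The links (of all nonempty faces) of `Y` are `β`-coboundary expanders over `G`. -/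
def HasCobExpandingLinks (Y : Finset (Finset V)) (d : ℕ) (G : Type*) [AddCommGroup G]
    (β : ℝ) : Prop :=
  ∀ σ ∈ Y, σ.Nonempty → IsCoboundaryExpander (link Y σ) (d + 1 - σ.card) G β

/-- For a family `A` of faces with `c` vertices (i.e. `A ⊆ X(k)` with `c = k+1`),
`Sbar Y t c A η r` is the set `S̄_{k-1-r}` of "fat" faces of cardinality `c-1-r`:
`S̄_{k-1} = {σ ∈ X(k-1) : ‖A_σ‖ > η}` and, going down,
`S̄_i = {σ ∈ X(i) : ‖(S̄_{i+1})_σ‖ > η^{2^{k-i-1}}}`. -/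
noncomputable def Sbar (Y : Finset (Finset V)) (t c : ℕ) (A : Finset (Finset V)) (η : ℝ) :
    ℕ → Finset (Finset V)
  | 0 => (facesCard Y (c - 1)).filter fun σ => η < locWt Y t A c σ
  | r + 1 =>
      (facesCard Y (c - 1 - (r + 1))).filter fun σ =>
        η ^ 2 ^ (r + 1) < locWt Y t (Sbar Y t c A η r) (c - 1 - r) σ

/-- `Υ`: the set of `(k+1)`-faces (cardinality `c+1`, where `c = k+1`) containing two
`i`-faces `σ, σ' ∈ S̄_i` (for some `i ≥ 0`) with `σ ∪ σ' ∈ X(i+1)` and `σ ∩ σ' ∈ S_{i-1}`. -/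
noncomputable def Upsilon (Y : Finset (Finset V)) (t c : ℕ) (A : Finset (Finset V))
    (η : ℝ) : Finset (Finset V) :=
  (facesCard Y (c + 1)).filter fun τ => ∃ r : ℕ, r + 2 ≤ c ∧
    ∃ σ ∈ Sbar Y t c A η r, ∃ σ' ∈ Sbar Y t c A η r, σ ⊆ τ ∧ σ' ⊆ τ ∧
      σ ∪ σ' ∈ facesCard Y (c - r) ∧
      σ ∩ σ' ∈ facesCard Y (c - 2 - r) \ Sbar Y t c A η (r + 1)

/-- `f↓σ` (for `σ` of cardinality `c-1-r`, i.e. an `(k-r)`-dimensional... face): the members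
`τ` of `A` admitting a chain of containments `τ ⊃ τ_{k-1} ⊃ ⋯ ⊃ τ_{i+1} ⊃ σ` with each
`τ_j ∈ S̄_j`. -/
noncomputable def fdown (Y : Finset (Finset V)) (t c : ℕ) (A : Finset (Finset V)) (η : ℝ) :
    ℕ → Finset V → Finset (Finset V)
  | 0, σ => A.filter fun τ => σ ⊆ τ
  | r + 1, σ =>
      A.filter fun τ => ∃ τ' ∈ Sbar Y t c A η r, σ ⊆ τ' ∧ τ' ≠ σ ∧ τ ∈ fdown Y t c A η r τ'

end Abelian

section NonAbelian

variable {G : Type*} [Group G]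

/-- A 0-cochain over a (possibly non-abelian) group: vanishes on non-vertices. -/
def IsC0 (Y : Finset (Finset V)) (f : V → G) : Prop :=
  ∀ v : V, ({v} : Finset V) ∉ Y → f v = 1

/-- A 1-cochain over a (possibly non-abelian) group: antisymmetric, supported on edges. -/
def IsC1 (Y : Finset (Finset V)) (g : V → V → G) : Prop :=
  (∀ u v : V, g v u = (g u v)⁻¹) ∧
    ∀ u v : V, ({u, v} : Finset V) ∉ Y ∨ u = v → g u v = 1

/-- A 2-cochain over a (possibly non-abelian) group: antisymmetric, supported on triangles. -/
def IsC2 (Y : Finset (Finset V)) (f : V → V → V → G) : Prop :=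
  (∀ u v w : V, f u v w = f v w u) ∧ (∀ u v w : V, f v u w = (f u v w)⁻¹) ∧
    ∀ u v w : V, ({u, v, w} : Finset V) ∉ Y ∨ u = v ∨ u = w ∨ v = w → f u v w = 1

/-- The coboundary of a 0-cochain: `δ(f)(u,v) = f(u)·f(v)⁻¹`. -/
def d0 (f : V → G) : V → V → G := fun u v => f u * (f v)⁻¹

/-- The coboundary of a 1-cochain: `δ(g)(u,v,w) = g(u,v)·g(v,w)·g(w,u)`. -/
def d1 (g : V → V → G) : V → V → V → G := fun u v w => g u v * g v w * g w u

/-- The support (a set of vertices, as singleton faces) of a `G`-valued function. -/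
noncomputable def supp0 (Y : Finset (Finset V)) (f : V → G) : Finset (Finset V) :=
  (facesCard Y 1).filter fun s => ∃ v : V, ({v} : Finset V) = s ∧ f v ≠ 1

/-- The support (a set of edges) of a `G`-valued function on ordered edges. -/
noncomputable def supp1 (Y : Finset (Finset V)) (g : V → V → G) : Finset (Finset V) :=
  (facesCard Y 2).filter fun e => ∃ u v : V, ({u, v} : Finset V) = e ∧ u ≠ v ∧ g u v ≠ 1

/-- The support (a set of triangles) of a `G`-valued function on ordered triangles. -/
noncomputable def supp2 (Y : Finset (Finset V)) (f : V → V → V → G) : Finset (Finset V) :=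
  (facesCard Y 3).filter fun s =>
    ∃ u v w : V, ({u, v, w} : Finset V) = s ∧ u ≠ v ∧ u ≠ w ∧ v ≠ w ∧ f u v w ≠ 1

/-- The action of 0-cochains on 1-cochains: `h.g(u,v) = h(u)·g(u,v)·h(v)⁻¹`. -/
def act (h : V → G) (g : V → V → G) : V → V → G := fun u v => h u * g u v * (h v)⁻¹

/-- The norm of a 1-cochain: the weight of its support. -/
noncomputable def norm1 (Y : Finset (Finset V)) (t : ℕ) (g : V → V → G) : ℝ :=
  wt Y t 2 (supp1 Y g)

/-- The norm of a 2-cochain: the weight of its support. -/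
noncomputable def norm2 (Y : Finset (Finset V)) (t : ℕ) (f : V → V → V → G) : ℝ :=
  wt Y t 3 (supp2 Y f)

/-- The distance between two 1-cochains: `dist(g,g') = ‖g'g⁻¹‖`. -/
noncomputable def dist1 (Y : Finset (Finset V)) (t : ℕ) (g g' : V → V → G) : ℝ :=
  norm1 Y t fun u v => g' u v * (g u v)⁻¹

/-- A minimal 1-cochain: its weight cannot be decreased by acting with a 0-cochain. -/
def Minimal1 (Y : Finset (Finset V)) (t : ℕ) (g : V → V → G) : Prop :=
  ∀ h : V → G, IsC0 Y h → norm1 Y t g ≤ norm1 Y t (act h g)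

/-- The localization `f_v` of a 2-cochain to the link of `v`: `f_v(u,w) = f(v,u,w)`. -/
def locC1 (f : V → V → V → G) (v : V) : V → V → G := fun u w => f v u w

/-- A locally minimal 2-cochain: all its localizations to links of vertices are minimal. -/
def LocallyMinimal2 (Y : Finset (Finset V)) (t : ℕ) (f : V → V → V → G) : Prop :=
  ∀ v : V, ({v} : Finset V) ∈ Y → Minimal1 (link Y {v}) (t - 1) (locC1 f v)

/-- A 1-coboundary: `g = δ(h)` on the edges, for some 0-cochain `h`. -/
def IsCoboundary1 (Y : Finset (Finset V)) (g : V → V → G) : Prop :=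
  ∃ h : V → G, IsC0 Y h ∧
    ∀ u v : V, ({u, v} : Finset V) ∈ Y → u ≠ v → g u v = h u * (h v)⁻¹

/-- A 1-cocycle: a 1-cochain whose coboundary is trivial on all triangles. -/
def IsCocycle1 (Y : Finset (Finset V)) (g : V → V → G) : Prop :=
  IsC1 Y g ∧ ∀ u v w : V, ({u, v, w} : Finset V) ∈ Y → u ≠ v → u ≠ w → v ≠ w →
    d1 g u v w = 1

/-- A constant 0-cochain (member of `B⁰`). -/
def IsConst0 (Y : Finset (Finset V)) (f : V → G) : Prop :=
  ∃ c : G, ∀ v : V, ({v} : Finset V) ∈ Y → f v = c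

/-- The distance of a 0-cochain from `B⁰` (the constants). -/
noncomputable def distB0 (Y : Finset (Finset V)) (t : ℕ) (f : V → G) : ℝ :=
  sInf {r : ℝ | ∃ c : G, r = wt Y t 1 (supp0 Y fun v => f v * c⁻¹)}

/-- The distance of a 1-cochain from the 1-coboundaries. -/
noncomputable def distB1 (Y : Finset (Finset V)) (t : ℕ) (g : V → V → G) : ℝ :=
  sInf {r : ℝ | ∃ h : V → G, IsC0 Y h ∧ r = dist1 Y t g (act h g)}

/-- The distance of a 1-cochain from the 1-cocycles. -/
noncomputable def distZ1 (Y : Finset (Finset V)) (t : ℕ) (g : V → V → G) : ℝ :=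
  sInf {r : ℝ | ∃ g' : V → V → G, IsCocycle1 Y g' ∧ r = dist1 Y t g g'}

/-- A `β`-coboundary expander over a (possibly non-abelian) group `G`, for a complex with top
faces of cardinality `t`: in every dimension (0 and 1) below the dimension of the complex,
every cochain which is not a coboundary satisfies `‖δ(f)‖ ≥ β·dist(f,B)`. -/
def CobExpanderNA (Y : Finset (Finset V)) (t : ℕ) (G : Type*) [Group G] (β : ℝ) : Prop :=
  (2 ≤ t → ∀ f : V → G, IsC0 Y f → ¬IsConst0 Y f →
      norm1 Y t (d0 f) ≥ β * distB0 Y t f) ∧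
    (3 ≤ t → ∀ g : V → V → G, IsC1 Y g → ¬IsCoboundary1 Y g →
      norm2 Y t (d1 g) ≥ β * distB1 Y t g)

/-- The links (of all nonempty faces) of `Y` are `β`-coboundary expanders over `G`. -/
def HasCobExpandingLinksNA (Y : Finset (Finset V)) (d : ℕ) (G : Type*) [Group G]
    (β : ℝ) : Prop :=
  ∀ σ ∈ Y, σ.Nonempty → CobExpanderNA (link Y σ) (d + 1 - σ.card) G β

end NonAbelian

end HDX

namespace HDX14

open HDX

section analytic

variable {V : Type*} [Fintype V]

theorem bil (w : V → V → ℝ) (lam : ℝ) (hl : 0 ≤ lam) (hw : ∀ u v, 0 ≤ w u v)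
    (hs : ∀ u v, w u v = w v u) (hE : IsSpectralExpanderW w lam) (p q : V → ℝ) :
    ∑ u, ∑ v, w u v * p u * q v ≤
      (∑ u, (∑ v, w u v) * p u) * (∑ u, (∑ v, w u v) * q u) / (∑ u, ∑ v, w u v)
      + lam / 2 * (∑ u, (∑ v, w u v) * p u ^ 2 + ∑ u, (∑ v, w u v) * q u ^ 2) := by
  set d : V → ℝ := fun u => ∑ v, w u v with hd
  have hd0 : ∀ u, 0 ≤ d u := fun u => Finset.sum_nonneg fun v _ => hw u v
  set D : ℝ := ∑ u, d u with hD
  have hDn : 0 ≤ D := Finset.sum_nonneg fun u _ => hd0 u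
  change _ ≤ (∑ u, d u * p u) * (∑ u, d u * q u) / D
      + lam / 2 * (∑ u, d u * p u ^ 2 + ∑ u, d u * q u ^ 2)
  have hpn : 0 ≤ ∑ u, d u * p u ^ 2 := Finset.sum_nonneg fun u _ => mul_nonneg (hd0 u) (sq_nonneg _)
  have hqn : 0 ≤ ∑ u, d u * q u ^ 2 := Finset.sum_nonneg fun u _ => mul_nonneg (hd0 u) (sq_nonneg _)
  rcases hDn.eq_or_lt with h0 | hpos
  · have hdz : ∀ u, d u = 0 := fun u =>
      (Finset.sum_eq_zero_iff_of_nonneg (fun u _ => hd0 u)).1 h0.symm u (Finset.mem_univ _)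
    have hwz : ∀ u v, w u v = 0 := fun u v =>
      (Finset.sum_eq_zero_iff_of_nonneg (fun v _ => hw u v)).1 (hdz u) v (Finset.mem_univ _)
    simp [hwz, hdz]
  · set P := (∑ u, d u * p u) with hP
    set Q := (∑ u, d u * q u) with hQ
    set a := P / D with ha
    set b := Q / D with hb
    have haD : a * D = P := by rw [ha]; field_simp
    have hbD : b * D = Q := by rw [hb]; field_simp
    -- row and column sums
    have hrow : ∀ r : V → ℝ, ∑ u, ∑ v, w u v * r u = ∑ u, d u * r u := by
      intro r; simp only [hd, Finset.sum_mul]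
    have hcol : ∀ r : V → ℝ, ∑ u, ∑ v, w u v * r v = ∑ u, d u * r u := by
      intro r; rw [Finset.sum_comm]; simp only [hd, Finset.sum_mul]
      refine Finset.sum_congr rfl fun u _ => Finset.sum_congr rfl fun v _ => ?_
      rw [hs]
    have hdc : ∀ (r : V → ℝ) (c : ℝ), ∑ u, d u * (r u - c) = (∑ u, d u * r u) - c * D := by
      intro r c; rw [hD, Finset.mul_sum, ← Finset.sum_sub_distrib]
      exact Finset.sum_congr rfl fun u _ => by ring
    have hdc2 : ∀ (r : V → ℝ) (c : ℝ), ∑ u, d u * (r u - c) ^ 2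
        = (∑ u, d u * r u ^ 2) - 2 * c * (∑ u, d u * r u) + c ^ 2 * D := by
      intro r c
      rw [hD, Finset.mul_sum, Finset.mul_sum, ← Finset.sum_sub_distrib, ← Finset.sum_add_distrib]
      exact Finset.sum_congr rfl fun u _ => by ring
    have h1 := hE (fun u => (p u - a) + (q u - b)) (by
      change ∑ u, d u * ((p u - a) + (q u - b)) = 0
      simp only [mul_add, Finset.sum_add_distrib, hdc]
      linarith)
    have h2 := hE (fun u => (p u - a) - (q u - b)) (by
      change ∑ u, d u * ((p u - a) - (q u - b)) = 0
      have e1 := hdc p a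
      have e2 := hdc q b
      have e3 : ∑ u, d u * ((p u - a) - (q u - b))
          = ∑ u, d u * (p u - a) - ∑ u, d u * (q u - b) := by
        rw [← Finset.sum_sub_distrib]
        exact Finset.sum_congr rfl fun u _ => by ring
      rw [e3, e1, e2]
      linarith)
    have h1' := (abs_le.1 h1).2
    have h2' := (abs_le.1 h2).1
    have hpol : (∑ u, ∑ v, w u v * ((p u - a) + (q u - b)) * ((p v - a) + (q v - b)))
        - (∑ u, ∑ v, w u v * ((p u - a) - (q u - b)) * ((p v - a) - (q v - b)))
        = 4 * ((∑ u, ∑ v, w u v * p u * q v) - a * Q - b * P + a * b * D) := by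
      have e1 : ∑ u, ∑ v, w u v * p v * q u = ∑ u, ∑ v, w u v * p u * q v := by
        rw [Finset.sum_comm]
        refine Finset.sum_congr rfl fun u _ => Finset.sum_congr rfl fun v _ => ?_
        rw [hs]
      have e2 : D = ∑ u, ∑ v, w u v := rfl
      have : ∀ u v, w u v * ((p u - a) + (q u - b)) * ((p v - a) + (q v - b))
        - w u v * ((p u - a) - (q u - b)) * ((p v - a) - (q v - b))
        = 2 * (w u v * p u * q v) + 2 * (w u v * p v * q u) - 2 * a * (w u v * q u)
          - 2 * a * (w u v * q v) - 2 * b * (w u v * p u) - 2 * b * (w u v * p v)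
          + 4 * a * b * w u v := fun u v => by ring
      simp only [← Finset.sum_sub_distrib, this]
      simp only [Finset.sum_sub_distrib, Finset.sum_add_distrib, ← Finset.mul_sum]
      rw [e1, hrow q, hcol q, hrow p, hcol p, ← e2]
      ring
    have hpar : (∑ u, d u * ((p u - a) + (q u - b)) ^ 2) + (∑ u, d u * ((p u - a) - (q u - b)) ^ 2)
        = 2 * (∑ u, d u * (p u - a) ^ 2 + ∑ u, d u * (q u - b) ^ 2) := by
      rw [← Finset.sum_add_distrib, ← Finset.sum_add_distrib, Finset.mul_sum]
      exact Finset.sum_congr rfl fun u _ => by ring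
    have hp2 : ∑ u, d u * (p u - a) ^ 2 ≤ ∑ u, d u * p u ^ 2 := by
      rw [hdc2, ← hP, ← haD]; nlinarith [mul_nonneg (sq_nonneg a) hDn]
    have hq2 : ∑ u, d u * (q u - b) ^ 2 ≤ ∑ u, d u * q u ^ 2 := by
      rw [hdc2, ← hQ, ← hbD]; nlinarith [mul_nonneg (sq_nonneg b) hDn]
    have hkey : 4 * ((∑ u, ∑ v, w u v * p u * q v) - a * Q - b * P + a * b * D)
       ≤ lam * (2 * (∑ u, d u * p u ^ 2 + ∑ u, d u * q u ^ 2)) := by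
      rw [← hpol]
      calc _ ≤ lam * ((∑ u, d u * ((p u - a) + (q u - b)) ^ 2)
                + (∑ u, d u * ((p u - a) - (q u - b)) ^ 2)) := by
            rw [mul_add]; linarith
        _ ≤ _ := by rw [hpar]; gcongr
    have : P * Q / D = a * Q := by rw [ha]; ring
    rw [this]
    have : b * P = a * b * D := by rw [← haD]; ring
    linarith

theorem avg_mul (w q : V → ℝ) (hw : ∀ u, 0 ≤ w u) :
    (∑ u, w u) * ((∑ u, w u * q u) / ∑ u, w u) = ∑ u, w u * q u := by
  by_cases h : ∑ u, w u = 0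
  · have hz : ∀ u, w u = 0 := fun u =>
      (Finset.sum_eq_zero_iff_of_nonneg (fun u _ => hw u)).1 h u (Finset.mem_univ _)
    simp [hz]
  · field_simp

theorem avg_nonneg (w q : V → ℝ) (hw : ∀ u, 0 ≤ w u) (hq : ∀ u, 0 ≤ q u) :
    0 ≤ (∑ u, w u * q u) / ∑ u, w u :=
  div_nonneg (Finset.sum_nonneg fun u _ => mul_nonneg (hw u) (hq u))
    (Finset.sum_nonneg fun u _ => hw u)

theorem avg_le_one (w q : V → ℝ) (hw : ∀ u, 0 ≤ w u) (hq : ∀ u, q u ≤ 1) :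
    (∑ u, w u * q u) / ∑ u, w u ≤ 1 :=
  div_le_one_of_le₀ (Finset.sum_le_sum fun u _ => mul_le_of_le_one_right (hw u) (hq u))
    (Finset.sum_nonneg fun u _ => hw u)

theorem sum_sq_le (w q : V → ℝ) (hw : ∀ u, 0 ≤ w u) (hq : ∀ u, 0 ≤ q u) (hq1 : ∀ u, q u ≤ 1) :
    ∑ u, w u * q u ^ 2 ≤ ∑ u, w u * q u :=
  Finset.sum_le_sum fun u _ => mul_le_mul_of_nonneg_left
    (by nlinarith [hq u, hq1 u]) (hw u)

/-- main variance bound -/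
theorem var_bound (W : V → V → V → V → ℝ) (W3 : V → V → V → ℝ) (W2 : V → V → ℝ) (W1 : V → ℝ)
    (W0 lam : ℝ) (hl : 0 ≤ lam)
    (hW : ∀ a b c d, 0 ≤ W a b c d)
    (h3 : ∀ a b c, ∑ d, W a b c d = W3 a b c) (h2 : ∀ a b, ∑ c, W3 a b c = W2 a b)
    (h1 : ∀ a, ∑ b, W2 a b = W1 a) (h0 : ∑ a, W1 a = W0)
    (s12 : ∀ a b c d, W a b c d = W b a c d) (s23 : ∀ a b c d, W a b c d = W a c b d)
    (s34 : ∀ a b c d, W a b c d = W a b d c)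
    (E2 : ∀ x y, IsSpectralExpanderW (fun u v => W x y u v) lam)
    (E1 : ∀ x, IsSpectralExpanderW (fun u v => W3 x u v) lam)
    (E0 : IsSpectralExpanderW (fun u v => W2 u v) lam)
    (f : V → V → V → ℝ) (hf0 : ∀ a b c, 0 ≤ f a b c) (hf1 : ∀ a b c, f a b c ≤ 1)
    (g : V → ℝ) (hg0 : ∀ a, 0 ≤ g a) (hg1 : ∀ a, g a ≤ 1)
    (hg : ∀ a, W1 a * g a = ∑ b, ∑ c, ∑ d, W a b c d * f b c d) :
    ∑ a, W1 a * g a ^ 2 ≤ (∑ a, W1 a * g a) ^ 2 / W0 + 3 * lam * ∑ a, W1 a * g a := by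
  have n3 : ∀ a b c, 0 ≤ W3 a b c := fun a b c => by
    rw [← h3]; exact Finset.sum_nonneg fun d _ => hW _ _ _ _
  have n2 : ∀ a b, 0 ≤ W2 a b := fun a b => by
    rw [← h2]; exact Finset.sum_nonneg fun d _ => n3 _ _ _
  have n1 : ∀ a, 0 ≤ W1 a := fun a => by
    rw [← h1]; exact Finset.sum_nonneg fun d _ => n2 _ _
  have t12 : ∀ a b c, W3 a b c = W3 b a c := fun a b c => by
    rw [← h3, ← h3]; exact Finset.sum_congr rfl fun d _ => s12 _ _ _ _
  have t23 : ∀ a b c, W3 a b c = W3 a c b := fun a b c => by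
    rw [← h3, ← h3]; exact Finset.sum_congr rfl fun d _ => s23 _ _ _ _
  have r12 : ∀ a b, W2 a b = W2 b a := fun a b => by
    rw [← h2, ← h2]; exact Finset.sum_congr rfl fun d _ => t12 _ _ _
  set Φ := ∑ a, W1 a * g a with hΦ
  set f2 : V → V → ℝ := fun b c => (∑ d, W3 b c d * f b c d) / ∑ d, W3 b c d with hf2
  set f1 : V → ℝ := fun b => (∑ c, W2 b c * f2 b c) / ∑ c, W2 b c with hf1'
  have f20 : ∀ b c, 0 ≤ f2 b c := fun b c => avg_nonneg _ _ (n3 b c) (hf0 b c)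
  have f21 : ∀ b c, f2 b c ≤ 1 := fun b c => avg_le_one _ _ (n3 b c) (hf1 b c)
  have f10 : ∀ b, 0 ≤ f1 b := fun b => avg_nonneg _ _ (n2 b) (f20 b)
  have f11 : ∀ b, f1 b ≤ 1 := fun b => avg_le_one _ _ (n2 b) (f21 b)
  have m2 : ∀ b c, W2 b c * f2 b c = ∑ d, W3 b c d * f b c d := fun b c => by
    rw [← h2 b c]; exact avg_mul _ _ (n3 b c)
  have m1 : ∀ b, W1 b * f1 b = ∑ c, W2 b c * f2 b c := fun b => by
    rw [← h1 b]; exact avg_mul _ _ (n2 b)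
  have hrot : ∀ a b c d, W a b c d = W b c d a := fun a b c d => by
    rw [s12, s23, s34]
  have hΦ3 : ∑ b, ∑ c, ∑ d, W3 b c d * f b c d = Φ := by
    rw [hΦ]
    simp only [hg, ← h3, Finset.sum_mul]
    rw [Finset.sum_comm]
    conv_rhs => rw [Finset.sum_comm]
    rw [Finset.sum_comm]
    refine Finset.sum_congr rfl fun b _ => ?_
    conv_rhs => rw [Finset.sum_comm]
    refine Finset.sum_congr rfl fun c _ => ?_
    conv_rhs => rw [Finset.sum_comm]
    refine Finset.sum_congr rfl fun d _ => ?_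
    refine Finset.sum_congr rfl fun a _ => ?_
    rw [hrot a b c d]
  have hΦ2 : ∑ b, ∑ c, W2 b c * f2 b c = Φ := by rw [← hΦ3]; simp only [m2]
  have hΦ1 : ∑ b, W1 b * f1 b = Φ := by rw [← hΦ2]; simp only [m1]
  have hQ : ∑ a, W1 a * g a ^ 2 ≤ Φ := sum_sq_le _ _ n1 hg0 hg1
  -- step 1
  have st1 : ∑ a, W1 a * g a ^ 2 ≤ (∑ b, ∑ c, ∑ a, W3 b c a * g a * f2 b c) + lam * Φ := by
    have e : ∑ a, W1 a * g a ^ 2 = ∑ b, ∑ c, ∑ a, ∑ d, W b c a d * g a * f b c d := by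
      have : ∀ a, W1 a * g a ^ 2 = ∑ b, ∑ c, ∑ d, W b c a d * g a * f b c d := fun a => by
        rw [pow_two, ← mul_assoc, hg]
        simp only [Finset.sum_mul]
        refine Finset.sum_congr rfl fun b _ => Finset.sum_congr rfl fun c _ =>
          Finset.sum_congr rfl fun d _ => ?_
        rw [s12 a b c d, s23 b a c d]; ring
      simp only [this]
      rw [Finset.sum_comm]
      refine Finset.sum_congr rfl fun b _ => ?_
      rw [Finset.sum_comm]
    have en1 : ∑ b, ∑ c, ∑ a, W3 b c a * g a ^ 2 ≤ Φ := by
      refine le_trans (le_of_eq ?_) hQ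
      have : ∀ a, W1 a * g a ^ 2 = ∑ b, ∑ c, W3 b c a * g a ^ 2 := fun a => by
        rw [← h1]; simp only [← h2, Finset.sum_mul]
        refine Finset.sum_congr rfl fun b _ => Finset.sum_congr rfl fun c _ => ?_
        rw [t12 a b c, t23 b a c]
      simp only [this]
      conv_rhs => rw [Finset.sum_comm]
      refine Finset.sum_congr rfl fun b _ => ?_
      conv_rhs => rw [Finset.sum_comm]
    have en2 : ∑ b, ∑ c, ∑ d, W3 b c d * f b c d ^ 2 ≤ Φ := by
      rw [← hΦ3]
      exact Finset.sum_le_sum fun b _ => Finset.sum_le_sum fun c _ =>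
        sum_sq_le _ _ (n3 b c) (hf0 b c) (hf1 b c)
    have key : ∀ b c, ∑ a, ∑ d, W b c a d * g a * f b c d ≤
        (∑ a, W3 b c a * g a * f2 b c) + lam / 2 * (∑ a, W3 b c a * g a ^ 2
          + ∑ d, W3 b c d * f b c d ^ 2) := fun b c => by
      have := bil (fun u v => W b c u v) lam hl (hW b c) (fun u v => s34 b c u v) (E2 b c)
        g (f b c)
      simp only [h3] at this
      refine this.trans (le_of_eq ?_)
      rw [← Finset.sum_mul, hf2, mul_div_assoc]
    rw [e]
    calc _ ≤ ∑ b, ∑ c, ((∑ a, W3 b c a * g a * f2 b c) + lam / 2 * (∑ a, W3 b c a * g a ^ 2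
          + ∑ d, W3 b c d * f b c d ^ 2)) :=
          Finset.sum_le_sum fun b _ => Finset.sum_le_sum fun c _ => key b c
      _ = (∑ b, ∑ c, ∑ a, W3 b c a * g a * f2 b c) + lam / 2 *
            (∑ b, ∑ c, ∑ a, W3 b c a * g a ^ 2 + ∑ b, ∑ c, ∑ d, W3 b c d * f b c d ^ 2) := by
          simp only [Finset.sum_add_distrib, ← Finset.mul_sum]
      _ ≤ (∑ b, ∑ c, ∑ a, W3 b c a * g a * f2 b c) + lam / 2 * (Φ + Φ) := by gcongr
      _ = _ := by ring
  have st2 : (∑ b, ∑ c, ∑ a, W3 b c a * g a * f2 b c)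
      ≤ (∑ b, ∑ a, W2 b a * g a * f1 b) + lam * Φ := by
    have en1 : ∑ b, ∑ a, W2 b a * g a ^ 2 ≤ Φ := by
      refine le_trans (le_of_eq ?_) hQ
      rw [Finset.sum_comm]
      refine Finset.sum_congr rfl fun a _ => ?_
      rw [← h1, Finset.sum_mul]
      refine Finset.sum_congr rfl fun b _ => ?_
      rw [r12]
    have en2 : ∑ b, ∑ c, W2 b c * f2 b c ^ 2 ≤ Φ := by
      rw [← hΦ2]
      exact Finset.sum_le_sum fun b _ => sum_sq_le _ _ (n2 b) (f20 b) (f21 b)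
    have key : ∀ b, ∑ c, ∑ a, W3 b c a * g a * f2 b c ≤
        (∑ a, W2 b a * g a * f1 b) + lam / 2 * (∑ a, W2 b a * g a ^ 2
          + ∑ c, W2 b c * f2 b c ^ 2) := fun b => by
      have := bil (fun u v => W3 b u v) lam hl (n3 b) (fun u v => t23 b u v) (E1 b) g (f2 b)
      simp only [h2] at this
      rw [Finset.sum_comm]
      refine (le_of_eq ?_).trans (this.trans (le_of_eq ?_))
      · refine Finset.sum_congr rfl fun a _ => Finset.sum_congr rfl fun c _ => ?_
        rw [t23]
      · rw [← Finset.sum_mul, hf1', mul_div_assoc]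
    calc _ ≤ ∑ b, ((∑ a, W2 b a * g a * f1 b) + lam / 2 * (∑ a, W2 b a * g a ^ 2
          + ∑ c, W2 b c * f2 b c ^ 2)) := Finset.sum_le_sum fun b _ => key b
      _ = (∑ b, ∑ a, W2 b a * g a * f1 b) + lam / 2 *
            (∑ b, ∑ a, W2 b a * g a ^ 2 + ∑ b, ∑ c, W2 b c * f2 b c ^ 2) := by
          simp only [Finset.sum_add_distrib, ← Finset.mul_sum]
      _ ≤ (∑ b, ∑ a, W2 b a * g a * f1 b) + lam / 2 * (Φ + Φ) := by gcongr
      _ = _ := by ring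
  have st3 : (∑ b, ∑ a, W2 b a * g a * f1 b) ≤ Φ ^ 2 / W0 + lam * Φ := by
    have := bil (fun u v => W2 u v) lam hl n2 r12 E0 g f1
    simp only [h1, h0, hΦ1] at this
    rw [← hΦ] at this
    have en2 : ∑ u, W1 u * f1 u ^ 2 ≤ Φ := by rw [← hΦ1]; exact sum_sq_le _ _ n1 f10 f11
    rw [Finset.sum_comm]
    calc _ = ∑ u, ∑ v, W2 u v * g u * f1 v :=
          Finset.sum_congr rfl fun a _ => Finset.sum_congr rfl fun c _ => by rw [r12]
      _ ≤ _ := this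
      _ ≤ Φ * Φ / W0 + lam / 2 * (Φ + Φ) := by gcongr
      _ = _ := by ring
  linarith

theorem cheb (W1 g : V → ℝ) (W0 lam η : ℝ) (hη : 0 < η) (n1 : ∀ a, 0 ≤ W1 a)
    (h0 : ∑ a, W1 a = W0) (hW0 : 0 < W0)
    (hm : (∑ a, W1 a * g a) / W0 ≤ η / 2)
    (hv : ∑ a, W1 a * g a ^ 2 ≤ (∑ a, W1 a * g a) ^ 2 / W0 + 3 * lam * ∑ a, W1 a * g a) :
    ∑ a, (if g a ≤ η then W1 a else 0) / W0 ≥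
      1 - 12 * (lam / η ^ 2) * ((∑ a, W1 a * g a) / W0) := by
  set Φ := ∑ a, W1 a * g a with hΦ
  set m := Φ / W0 with hmdef
  have hmW : m * W0 = Φ := by rw [hmdef]; field_simp
  have e : ∑ a, W1 a * (g a - m) ^ 2 = ∑ a, W1 a * g a ^ 2 - 2 * m * Φ + m ^ 2 * W0 := by
    rw [← h0, hΦ, Finset.mul_sum, Finset.mul_sum, ← Finset.sum_sub_distrib,
      ← Finset.sum_add_distrib]
    exact Finset.sum_congr rfl fun u _ => by ring
  have e2 : Φ ^ 2 / W0 = m * Φ := by rw [hmdef]; ring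
  have e3 : m ^ 2 * W0 = m * Φ := by rw [← hmW]; ring
  have hvar : ∑ a, W1 a * (g a - m) ^ 2 ≤ 3 * lam * Φ := by rw [e]; linarith
  have hch : ∑ a, (W1 a - if g a ≤ η then W1 a else 0) * (η ^ 2 / 4) ≤
      ∑ a, W1 a * (g a - m) ^ 2 := by
    refine Finset.sum_le_sum fun a _ => ?_
    split_ifs with h
    · simpa using mul_nonneg (n1 a) (sq_nonneg _)
    · rw [sub_zero]
      refine mul_le_mul_of_nonneg_left ?_ (n1 a)
      push Not at h
      nlinarith
  rw [← Finset.sum_mul, Finset.sum_sub_distrib, h0] at hch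
  rw [← Finset.sum_div, ge_iff_le, le_div_iff₀ hW0]
  set S := ∑ a, (if g a ≤ η then W1 a else 0)
  have h4 : (W0 - S) * (η ^ 2 / 4) ≤ 3 * lam * Φ := hch.trans hvar
  have h5 : W0 - S ≤ 12 * lam * Φ / η ^ 2 := by
    rw [le_div_iff₀ (by positivity)]; linarith
  have h6 : (1 - 12 * (lam / η ^ 2) * m) * W0 = W0 - 12 * lam * Φ / η ^ 2 := by
    rw [← hmW]; ring
  rw [h6]; linarith

theorem expander_smul (w w' : V → V → ℝ) (lam K : ℝ) (hK : 0 < K)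
    (h : ∀ u v, w' u v = K * w u v) (hE : IsSpectralExpanderW w lam) :
    IsSpectralExpanderW w' lam := by
  intro f hf
  have e : ∀ u, ∑ v, w' u v = K * ∑ v, w u v := fun u => by simp only [h, Finset.mul_sum]
  simp only [e, mul_assoc, ← Finset.mul_sum] at hf ⊢
  have := hE f (by simpa [hK.ne'] using hf)
  simp only [h, mul_assoc, ← Finset.mul_sum] at this ⊢
  rw [abs_mul, abs_of_pos hK]
  nlinarith

theorem lam_nonneg (w : V → V → ℝ) (lam : ℝ) (hE : IsSpectralExpanderW w lam)
    (hw : ∀ u v, 0 ≤ w u v) (hs : ∀ u v, w u v = w v u) (x y : V) (hxy : x ≠ y)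
    (hp : 0 < w x y) : 0 ≤ lam := by
  classical
  have hd : ∀ u v, w u v ≤ ∑ v, w u v := fun u v =>
    Finset.single_le_sum (f := fun v => w u v) (fun v _ => hw u v) (Finset.mem_univ v)
  have hx := hp.trans_le (hd x y)
  have hy := hp.trans_le (hs x y ▸ hd y x)
  set d : V → ℝ := fun u => ∑ v, w u v with hdd
  have hd0 : ∀ u, 0 ≤ d u := fun u => Finset.sum_nonneg fun v _ => hw u v
  set f : V → ℝ := fun u => if u = x then d y else if u = y then - d x else 0 with hf
  have h1 := hE f (by
    change ∑ u, d u * f u = 0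
    rw [← Finset.sum_subset (Finset.subset_univ {x, y})]
    · rw [Finset.sum_pair hxy]; simp [hf, hxy.symm]; ring
    · intro u _ hu; simp at hu; simp [hf, hu])
  have h2 : 0 < ∑ u, d u * f u ^ 2 := by
    refine Finset.sum_pos' (fun u _ => mul_nonneg (hd0 u) (sq_nonneg _)) ⟨x, Finset.mem_univ _, ?_⟩
    simp only [hf, if_true]; exact mul_pos hx (pow_pos hy 2)
  exact nonneg_of_mul_nonneg_left ((abs_nonneg _).trans h1) h2

end analytic

section comb

variable {V : Type*} [Fintype V] [DecidableEq V]

noncomputable def cnt (F : Finset (Finset V)) (s : Finset V) : ℝ :=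
  ((F.filter fun T => s ⊆ T).card : ℝ)

noncomputable def M (F : Finset (Finset V)) (k : ℕ) (s : Finset V) : ℝ :=
  if s.card = k then cnt F s else 0

theorem cnt_nonneg (F : Finset (Finset V)) (s : Finset V) : 0 ≤ cnt F s := Nat.cast_nonneg _

theorem M_nonneg (F : Finset (Finset V)) (k : ℕ) (s : Finset V) : 0 ≤ M F k s := by
  unfold M; split_ifs
  · exact cnt_nonneg _ _
  · exact le_rfl

theorem cnt_eq_sum (F : Finset (Finset V)) (s : Finset V) :
    cnt F s = ∑ T ∈ F, if s ⊆ T then (1 : ℝ) else 0 := by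
  simp [cnt]

theorem M_sum (F : Finset (Finset V)) (hF : ∀ T ∈ F, T.card = 4) (k : ℕ) (s : Finset V)
    (hs : s.card ≤ k) : ∑ d, M F (k + 1) (insert d s) = (4 - k : ℝ) * M F k s := by
  rcases hs.lt_or_eq with h | h
  · have : ∀ d, M F (k + 1) (insert d s) = 0 := fun d => by
      have := Finset.card_insert_le d s
      unfold M; rw [if_neg (by omega)]
    simp only [this, Finset.sum_const_zero]
    unfold M; rw [if_neg (by omega)]; simp
  · have e : ∀ d, M F (k + 1) (insert d s)
        = ∑ T ∈ F, if s ⊆ T then (if d ∈ T \ s then (1 : ℝ) else 0) else 0 := fun d => by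
      unfold M
      by_cases hd : d ∈ s
      · rw [Finset.insert_eq_of_mem hd, if_neg (by omega)]
        simp [hd]
      · rw [Finset.card_insert_of_notMem hd, if_pos (by omega), cnt_eq_sum]
        refine Finset.sum_congr rfl fun T _ => ?_
        simp only [Finset.insert_subset_iff, Finset.mem_sdiff, hd, not_false_eq_true, and_true]
        by_cases h1 : s ⊆ T <;> by_cases h2 : d ∈ T <;> simp [h1, h2]
    simp only [e]
    rw [Finset.sum_comm]
    unfold M
    rw [if_pos h, cnt_eq_sum, Finset.mul_sum]
    refine Finset.sum_congr rfl fun T hT => ?_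
    by_cases h1 : s ⊆ T
    · simp only [h1, if_true, mul_one]
      rw [Finset.sum_ite_mem, Finset.univ_inter, Finset.sum_const, nsmul_eq_mul, mul_one,
        Finset.card_sdiff_of_subset h1, Nat.cast_sub (Finset.card_le_card h1), hF T hT, h]
      simp
    · simp [h1]

theorem faces_link (X : Finset (Finset V)) (σ : Finset V) (t m : ℕ) (h : m + σ.card = t) :
    facesCard (link X σ) m = ((facesCard X t).filter fun T => σ ⊆ T).image fun T => T \ σ := by
  ext τ
  simp only [facesCard, link, localize, Finset.mem_filter, Finset.mem_image]
  constructor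
  · rintro ⟨⟨T, ⟨hT, hs⟩, rfl⟩, hc⟩
    have := Finset.card_sdiff_add_card_eq_card hs
    exact ⟨T, ⟨⟨hT, by omega⟩, hs⟩, rfl⟩
  · rintro ⟨T, ⟨⟨hT, hc⟩, hs⟩, rfl⟩
    have := Finset.card_sdiff_add_card_eq_card hs
    exact ⟨⟨T, ⟨hT, hs⟩, rfl⟩, by omega⟩

theorem link_inj (F : Finset (Finset V)) (σ : Finset V) :
    Set.InjOn (fun T => T \ σ) ((F.filter fun T => σ ⊆ T : Finset (Finset V)) : Set (Finset V)) := by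
  intro T hT T' hT' h
  simp only [Finset.coe_filter, Set.mem_setOf_eq] at hT hT'
  have h' : T \ σ = T' \ σ := h
  rw [← Finset.sdiff_union_of_subset hT.2, h', Finset.sdiff_union_of_subset hT'.2]

theorem wt_link (X : Finset (Finset V)) (σ : Finset V) (m j : ℕ) (A : Finset (Finset V))
    (h : m + σ.card = 4) :
    wt (link X σ) m j A = (∑ T ∈ (facesCard X 4).filter fun T => σ ⊆ T,
      ((((T \ σ).powersetCard j).filter (· ∈ A)).card : ℝ)) /
        (cnt (facesCard X 4) σ * (m.choose j : ℝ)) := by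
  unfold wt
  rw [faces_link X σ 4 m h, Finset.sum_image (link_inj _ _), Finset.card_image_of_injOn (link_inj _ _)]
  rfl

theorem edge_link (X : Finset (Finset V)) (σ : Finset V) (m : ℕ)
    (h : m + σ.card = 4) (u v : V) :
    edgeWt (link X σ) m u v = M (facesCard X 4) (σ.card + 2) (insert u (insert v σ)) /
      (cnt (facesCard X 4) σ * (m.choose 2 : ℝ)) := by
  unfold edgeWt
  by_cases huv : u = v
  · subst huv
    have := Finset.card_insert_le u σ
    unfold M
    rw [if_neg (by simp), Finset.insert_idem, if_neg (by omega), zero_div]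
  · rw [if_pos huv, wt_link X σ m 2 _ h]
    congr 1
    have e : ∀ T : Finset V, ((((T \ σ).powersetCard 2).filter (· ∈ ({({u, v} : Finset V)} :
        Finset (Finset V)))).card : ℝ) = if ({u, v} : Finset V) ⊆ T \ σ then 1 else 0 := fun T => by
      have : (((T \ σ).powersetCard 2).filter (· ∈ ({({u, v} : Finset V)} :
        Finset (Finset V)))) = if ({u, v} : Finset V) ⊆ T \ σ then {({u, v} : Finset V)} else ∅ := by
        ext τ
        simp only [Finset.mem_filter, Finset.mem_powersetCard, Finset.mem_singleton]
        split_ifs with h1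
        · simp only [Finset.mem_singleton]
          constructor
          · exact fun h => h.2
          · rintro rfl; exact ⟨⟨h1, Finset.card_pair huv⟩, rfl⟩
        · simp only [Finset.notMem_empty, iff_false]
          rintro ⟨⟨h2, _⟩, rfl⟩; exact h1 h2
      rw [this]; split_ifs <;> simp
    simp only [e]
    unfold M
    by_cases hm : u ∈ σ ∨ v ∈ σ
    · have hz : ∀ T : Finset V, ¬ ({u, v} : Finset V) ⊆ T \ σ := fun T hT => by
        have h1 := hT (Finset.mem_insert_self u {v})
        have h2 := hT (Finset.mem_insert_of_mem (Finset.mem_singleton_self v))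
        simp only [Finset.mem_sdiff] at h1 h2
        tauto
      have hc : (insert u (insert v σ)).card ≠ σ.card + 2 := by
        have h1 := Finset.card_insert_le v σ
        have h2 := Finset.card_insert_le u (insert v σ)
        rcases hm with hm | hm
        · rw [Finset.insert_eq_of_mem (Finset.mem_insert_of_mem hm)]; omega
        · rw [Finset.insert_eq_of_mem hm]
          have h2 := Finset.card_insert_le u σ
          omega
      rw [if_neg hc]; simp [hz]
    · push Not at hm
      have hc : (insert u (insert v σ)).card = σ.card + 2 := by
        rw [Finset.card_insert_of_notMem (by simp [huv, hm.1]), Finset.card_insert_of_notMem hm.2]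
      rw [if_pos hc, cnt_eq_sum, Finset.sum_filter]
      refine Finset.sum_congr rfl fun T _ => ?_
      have : insert u (insert v σ) ⊆ T ↔ σ ⊆ T ∧ ({u, v} : Finset V) ⊆ T \ σ := by
        simp only [Finset.insert_subset_iff, Finset.singleton_subset_iff, Finset.mem_sdiff]
        tauto
      simp only [this]
      by_cases h1 : σ ⊆ T <;> simp [h1]

theorem cnt_eq_zero (X : Finset (Finset V)) (hX : IsComplex X) (σ : Finset V) (hσ : σ ∉ X)  :
    cnt (facesCard X 4) σ = 0 := by
  unfold cnt
  rw [Nat.cast_eq_zero, Finset.card_eq_zero, Finset.filter_eq_empty_iff]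
  intro T hT hs
  exact hσ (hX T (Finset.mem_filter.1 hT).1 σ hs)

theorem cnt_mono (F : Finset (Finset V)) {s s' : Finset V} (h : s ⊆ s') : cnt F s' ≤ cnt F s := by
  unfold cnt
  exact_mod_cast Finset.card_le_card (Finset.monotone_filter_right _ fun T _ hT => h.trans hT)

theorem M_exp (X : Finset (Finset V)) (lam : ℝ) (hX : IsComplex X) (hP : IsPureDim X 3)
    (hE : IsLocalSpectralExpander X 3 lam) (σ : Finset V) (k : ℕ) (hk : k ≤ 2) (hσ : σ.card ≤ k) :
    IsSpectralExpanderW (fun u v => M (facesCard X 4) (k + 2) (insert u (insert v σ))) lam := by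
  by_cases hc : σ.card = k ∧ σ ∈ X
  · obtain ⟨rfl, hm⟩ := hc
    have hpos : 0 < cnt (facesCard X 4) σ := by
      obtain ⟨T, hT, hs, hc⟩ := hP.2.2 σ hm
      unfold cnt
      exact_mod_cast Finset.card_pos.2 ⟨T, by simp [facesCard, hT, hs, hc]⟩
    have hch : 0 < (((3 + 1 - σ.card).choose 2 : ℕ) : ℝ) := by
      exact_mod_cast Nat.choose_pos (by omega)
    refine expander_smul _ _ lam (cnt (facesCard X 4) σ * ((3 + 1 - σ.card).choose 2 : ℝ))
      (mul_pos hpos hch) (fun u v => ?_) (hE σ hm (by omega))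
    rw [edge_link X σ (3 + 1 - σ.card) (by omega)]
    field_simp
  · have : ∀ u v, M (facesCard X 4) (k + 2) (insert u (insert v σ)) = 0 := fun u v => by
      unfold M
      split_ifs with h
      · have h1 := Finset.card_insert_le v σ
        have h2 := Finset.card_insert_le u (insert v σ)
        have h3 : σ ∉ X := fun hh => hc ⟨by omega, hh⟩
        refine le_antisymm ?_ (cnt_nonneg _ _)
        rw [← cnt_eq_zero X hX σ h3]
        exact cnt_mono _ ((Finset.subset_insert _ _).trans (Finset.subset_insert _ _))
      · rfl
    intro f _
    simp [this]

/-- tetrahedra through `a` whose opposite triangle is in `A` -/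
noncomputable def Fa (X A : Finset (Finset V)) (a : V) : Finset (Finset V) :=
  (facesCard X 4).filter fun T => a ∈ T ∧ T \ {a} ∈ A

theorem wt_a (X A : Finset (Finset V)) (a : V) :
    wt (link X {a}) 3 3 A = ((Fa X A a).card : ℝ) / cnt (facesCard X 4) {a} := by
  rw [wt_link X {a} 3 3 A (by simp)]
  congr 1
  · unfold Fa
    rw [Finset.card_filter, Nat.cast_sum, Finset.sum_filter]
    refine Finset.sum_congr rfl fun T hT => ?_
    have hc : T.card = 4 := (Finset.mem_filter.1 hT).2
    simp only [Finset.singleton_subset_iff]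
    by_cases ha : a ∈ T
    · have h3 : (T \ {a}).card = 3 := by
        rw [Finset.card_sdiff_of_subset (by simpa using ha), hc]; simp
      rw [← h3, Finset.powersetCard_self, Finset.filter_singleton]
      by_cases hA : T \ {a} ∈ A <;> simp [ha, hA]
    · simp [ha]
  · simp

theorem Fa_le (X A : Finset (Finset V)) (a : V) :
    ((Fa X A a).card : ℝ) ≤ cnt (facesCard X 4) {a} := by
  unfold Fa cnt
  exact_mod_cast Finset.card_le_card (Finset.monotone_filter_right _ fun T _ hT => by simpa using hT.1)

theorem wt_mul (X A : Finset (Finset V)) (a : V) :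
    cnt (facesCard X 4) {a} * wt (link X {a}) 3 3 A = ((Fa X A a).card : ℝ) := by
  rw [wt_a]
  by_cases h : cnt (facesCard X 4) {a} = 0
  · have := Fa_le X A a
    rw [h] at this ⊢
    rw [zero_mul]; exact le_antisymm (Nat.cast_nonneg _) this
  · field_simp

theorem M_mul (X A : Finset (Finset V)) (a b c d : V) :
    M (facesCard X 4) 4 {d, c, b, a} * (if ({d, c, b} : Finset V) ∈ A then 1 else 0) =
      M (Fa X A a) 4 {d, c, b, a} := by
  unfold M
  split_ifs with h1 h2 h2
  · rw [mul_one]; unfold cnt Fa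
    rw [Finset.filter_filter]
    congr 2
    ext T
    simp only [Finset.mem_filter]
    refine and_congr_right fun hT => ⟨fun h => ⟨?_, h⟩, fun h => h.2⟩
    have hc : T.card = 4 := (Finset.mem_filter.1 hT).2
    have he := Finset.eq_of_subset_of_card_le h (by omega)
    rw [← he]
    refine ⟨by simp, ?_⟩
    convert h2 using 1
    have hn : a ∉ ({d, c, b} : Finset V) := fun hn => by
      have : ({d, c, b, a} : Finset V) = {d, c, b} := by
        ext x; simp only [Finset.mem_insert, Finset.mem_singleton] at hn ⊢
        constructor
        · rintro (h | h | h | rfl) <;> tauto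
        · tauto
      rw [this] at h1
      have := Finset.card_le_three (a := d) (b := c) (c := b)
      omega
    ext x
    simp only [Finset.mem_insert, Finset.mem_singleton, Finset.mem_sdiff] at hn ⊢
    constructor
    · tauto
    · intro hx
      refine ⟨by tauto, ?_⟩
      rintro rfl; exact hn hx
  · rw [mul_zero]; unfold cnt Fa
    symm
    rw [Nat.cast_eq_zero, Finset.card_eq_zero, Finset.filter_eq_empty_iff]
    intro T hT h
    simp only [Finset.mem_filter] at hT
    have hc : T.card = 4 := (Finset.mem_filter.1 hT.1).2
    have he := Finset.eq_of_subset_of_card_le h (by omega)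
    apply h2
    convert hT.2.2 using 1
    rw [← he]
    have hn : a ∉ ({d, c, b} : Finset V) := fun hn => by
      have : ({d, c, b, a} : Finset V) = {d, c, b} := by
        ext x; simp only [Finset.mem_insert, Finset.mem_singleton] at hn ⊢
        constructor
        · rintro (h | h | h | rfl) <;> tauto
        · tauto
      rw [this] at h1
      have := Finset.card_le_three (a := d) (b := c) (c := b)
      omega
    ext x
    simp only [Finset.mem_insert, Finset.mem_singleton, Finset.mem_sdiff] at hn ⊢
    constructor
    · intro hx
      refine ⟨by tauto, ?_⟩
      rintro rfl; exact hn hx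
    · tauto
  · simp
  · simp

theorem sum3 (F : Finset (Finset V)) (hF : ∀ T ∈ F, T.card = 4) (a b c : V) :
    ∑ d, M F 4 {d, c, b, a} = M F 3 {c, b, a} := by
  rw [M_sum F hF 3 {c, b, a} Finset.card_le_three]; norm_num

theorem sum2 (F : Finset (Finset V)) (hF : ∀ T ∈ F, T.card = 4) (a b : V) :
    ∑ c, M F 3 {c, b, a} = 2 * M F 2 {b, a} := by
  rw [M_sum F hF 2 {b, a} Finset.card_le_two]; norm_num

theorem sum1 (F : Finset (Finset V)) (hF : ∀ T ∈ F, T.card = 4) (a : V) :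
    ∑ b, 2 * M F 2 {b, a} = 6 * M F 1 {a} := by
  rw [← Finset.mul_sum, M_sum F hF 1 {a} (by simp)]; norm_num; ring

theorem M_one (F : Finset (Finset V)) (a : V) : M F 1 {a} = cnt F {a} := by simp [M]

theorem sum0 (F : Finset (Finset V)) (hF : ∀ T ∈ F, T.card = 4) :
    ∑ a, 6 * M F 1 {a} = 24 * (F.card : ℝ) := by
  have := M_sum F hF 0 ∅ (by simp)
  simp only [insert_empty_eq, zero_add] at this
  rw [← Finset.mul_sum, this]; simp [M, cnt]; ring

theorem hg_id (X A : Finset (Finset V)) (a : V) :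
    6 * M (facesCard X 4) 1 {a} * wt (link X {a}) 3 3 A =
      ∑ b, ∑ c, ∑ d, M (facesCard X 4) 4 {d, c, b, a} *
        (if ({d, c, b} : Finset V) ∈ A then 1 else 0) := by
  have hF : ∀ T ∈ Fa X A a, T.card = 4 := fun T hT =>
    (Finset.mem_filter.1 (Finset.mem_filter.1 hT).1).2
  simp only [M_mul, sum3 _ hF, sum2 _ hF, sum1 _ hF]
  rw [M_one, M_one, mul_assoc, wt_mul]
  congr 1
  unfold cnt
  rw [Finset.filter_true_of_mem]
  intro T hT
  simpa using (Finset.mem_filter.1 hT).2.1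

theorem sum_Fa (X A : Finset (Finset V)) :
    ∑ a, ((Fa X A a).card : ℝ) =
      ∑ T ∈ facesCard X 4, (((T.powersetCard 3).filter (· ∈ A)).card : ℝ) := by
  simp only [Fa, Finset.card_filter, Nat.cast_sum]
  rw [Finset.sum_comm]
  refine Finset.sum_congr rfl fun T hT => ?_
  have hc : T.card = 4 := (Finset.mem_filter.1 hT).2
  rw [← Nat.cast_sum, ← Nat.cast_sum, ← Finset.card_filter, ← Finset.card_filter]
  congr 1
  refine Finset.card_bij (fun a _ => T \ {a}) ?_ ?_ ?_
  · intro a ha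
    simp only [Finset.mem_filter, Finset.mem_univ, true_and] at ha
    simp only [Finset.mem_filter, Finset.mem_powersetCard]
    refine ⟨⟨Finset.sdiff_subset, ?_⟩, ha.2⟩
    rw [Finset.card_sdiff_of_subset (by simpa using ha.1), hc]; simp
  · intro a ha b hb h
    simp only [Finset.mem_filter, Finset.mem_univ, true_and] at ha hb
    by_contra hne
    have : a ∈ T \ {b} := by simp [ha.1, hne]
    rw [← h] at this
    simp at this
  · intro t ht
    simp only [Finset.mem_filter, Finset.mem_powersetCard] at ht
    have h1 : (T \ t).card = 1 := by rw [Finset.card_sdiff_of_subset ht.1.1, hc, ht.1.2]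
    obtain ⟨a, ha⟩ := Finset.card_eq_one.1 h1
    have e : T \ {a} = t := by rw [← ha, Finset.sdiff_sdiff_eq_self ht.1.1]
    have haT : a ∈ T := by
      have : a ∈ T \ t := by rw [ha]; simp
      exact (Finset.mem_sdiff.1 this).1
    exact ⟨a, by simp [e, ht.2, haT], e⟩

theorem wt_one (X : Finset (Finset V)) (hX : IsComplex X) (p : Finset V → Prop) :
    wt X 4 1 ((facesCard X 1).filter p) =
      ∑ a, (if p {a} then 6 * M (facesCard X 4) 1 {a} else 0) / (24 * ((facesCard X 4).card : ℝ)) := by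
  unfold wt
  rw [← Finset.sum_div]
  have e : ∑ T ∈ facesCard X 4, (((T.powersetCard 1).filter (· ∈ (facesCard X 1).filter p)).card : ℝ)
      = ∑ a, (if p {a} then cnt (facesCard X 4) {a} else 0) := by
    have h1 : ∀ a, (if p {a} then cnt (facesCard X 4) {a} else 0)
        = ∑ T ∈ facesCard X 4, if a ∈ T ∧ p {a} then (1 : ℝ) else 0 := fun a => by
      rw [cnt_eq_sum]
      by_cases h : p {a} <;> simp [h]
    simp only [h1]
    rw [Finset.sum_comm]
    refine Finset.sum_congr rfl fun T hT => ?_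
    rw [Finset.powersetCard_one, Finset.filter_map, Finset.card_map, Finset.card_filter]
    push_cast
    rw [← Finset.sum_subset (Finset.subset_univ T)]
    · refine Finset.sum_congr rfl fun a ha => ?_
      have : ({a} : Finset V) ∈ X := hX T (Finset.mem_filter.1 hT).1 _ (by simpa using ha)
      simp [facesCard, this, ha]
    · intro a _ ha; simp [ha]
  rw [e]
  simp only [M_one]
  have : ∑ a, (if p {a} then 6 * cnt (facesCard X 4) {a} else 0)
     = 6 * ∑ a, (if p {a} then cnt (facesCard X 4) {a} else 0) := by
    rw [Finset.mul_sum]; refine Finset.sum_congr rfl fun a _ => ?_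
    split_ifs <;> simp
  rw [this, show (24 * ((facesCard X 4).card : ℝ)) = 6 * (((facesCard X 4).card : ℝ) * 4) by ring,
    mul_div_mul_left _ _ (by norm_num)]
  norm_num

theorem main (X : Finset (Finset V)) (lam η : ℝ) (hX : IsComplex X) (hP : IsPureDim X 3)
    (hE : IsLocalSpectralExpander X 3 lam) (hη : 0 < η) (A : Finset (Finset V))
    (hA : wt X 4 3 A ≤ η / 2) :
    wt X 4 1 ((facesCard X 1).filter fun s => wt (link X s) 3 3 A ≤ η) ≥
      1 - 12 * (lam / η ^ 2) * wt X 4 3 A := by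
  have hF : ∀ T ∈ facesCard X 4, T.card = 4 := fun T hT => (Finset.mem_filter.1 hT).2
  obtain ⟨T0, hT0⟩ : ∃ T, T ∈ facesCard X 4 := by
    obtain ⟨σ, hσ⟩ := hP.1
    obtain ⟨T, hT, _, hc⟩ := hP.2.2 σ hσ
    exact ⟨T, Finset.mem_filter.2 ⟨hT, hc⟩⟩
  have hN : 0 < ((facesCard X 4).card : ℝ) := by exact_mod_cast Finset.card_pos.2 ⟨T0, hT0⟩
  have E0 := M_exp X lam hX hP hE ∅ 0 (by norm_num) (by simp)
  have hl : 0 ≤ lam := by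
    obtain ⟨x, hx, y, hy, hxy⟩ := Finset.one_lt_card.1 (show 1 < T0.card by rw [hF T0 hT0]; norm_num)
    refine lam_nonneg _ lam E0 (fun _ _ => M_nonneg _ _ _) (fun u v => by
      rw [Finset.insert_comm]) x y hxy ?_
    unfold M
    rw [if_pos (by simpa using Finset.card_pair hxy)]
    unfold cnt
    exact_mod_cast Finset.card_pos.2 ⟨T0, by simp [hT0, Finset.insert_subset_iff, hx, hy]⟩
  have hsum : ∑ a, 6 * M (facesCard X 4) 1 {a} * wt (link X {a}) 3 3 A =
      24 * ((facesCard X 4).card : ℝ) * wt X 4 3 A := by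
    simp only [mul_assoc, M_one, wt_mul, ← Finset.mul_sum, sum_Fa]
    unfold wt
    norm_num [Nat.choose]
    field_simp
    ring
  have hmean : (∑ a, 6 * M (facesCard X 4) 1 {a} * wt (link X {a}) 3 3 A) /
      (24 * ((facesCard X 4).card : ℝ)) = wt X 4 3 A := by
    rw [hsum]; field_simp
  have hv := var_bound (fun a b c d => M (facesCard X 4) 4 {d, c, b, a})
    (fun a b c => M (facesCard X 4) 3 {c, b, a}) (fun a b => 2 * M (facesCard X 4) 2 {b, a})
    (fun a => 6 * M (facesCard X 4) 1 {a}) (24 * ((facesCard X 4).card : ℝ)) lam hl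
    (fun _ _ _ _ => M_nonneg _ _ _) (sum3 _ hF) (sum2 _ hF) (sum1 _ hF) (sum0 _ hF)
    (fun a b c d => by simp only [Finset.pair_comm])
    (fun a b c d => by simp only [Finset.insert_comm b c])
    (fun a b c d => by simp only [Finset.insert_comm c d])
    (fun x y => by
      have := M_exp X lam hX hP hE {y, x} 2 (by norm_num) Finset.card_le_two
      simp only [Finset.insert_comm _ _ ({y, x} : Finset V)]
      convert this using 3 with u v
      )
    (fun x => by
      have := M_exp X lam hX hP hE {x} 1 (by norm_num) (by simp)
      convert this using 3 with u v
      rw [Finset.insert_comm])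
    (by
      refine expander_smul _ _ lam 2 (by norm_num) (fun u v => ?_) E0
      rw [Finset.insert_comm]; rfl)
    (fun b c d => if ({d, c, b} : Finset V) ∈ A then 1 else 0)
    (fun _ _ _ => by split_ifs <;> norm_num) (fun _ _ _ => by split_ifs <;> norm_num)
    (fun a => wt (link X {a}) 3 3 A)
    (fun a => by rw [wt_a]; exact div_nonneg (Nat.cast_nonneg _) (cnt_nonneg _ _))
    (fun a => by rw [wt_a]; exact div_le_one_of_le₀ (Fa_le X A a) (cnt_nonneg _ _))
    (hg_id X A)
  have := cheb (fun a => 6 * M (facesCard X 4) 1 {a}) (fun a => wt (link X {a}) 3 3 A)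
    (24 * ((facesCard X 4).card : ℝ)) lam η hη
    (fun a => mul_nonneg (by norm_num) (M_nonneg _ _ _)) (sum0 _ hF) (by positivity)
    (by rw [hmean]; exact hA) hv
  rw [hmean] at this
  rw [wt_one X hX]
  exact this

end comb
end HDX14

/-- there is a universal constant `C > 0` such that in any 3-dimensional
`λ`-local spectral expander, for `0 < η < 1` and any set `A` of triangles with
`‖A‖ ≤ η/2`, the set `S₀' = {v ∈ X(0) : ‖A^v‖ ≤ η}` satisfies
`‖S₀'‖ ≥ 1 - C·(λ/η²)·‖A‖`. -/
theorem stmt14 :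
    ∃ C : ℝ, 0 < C ∧
      ∀ (V : Type*) [Fintype V] [DecidableEq V] (X : Finset (Finset V)) (lam η : ℝ),
        HDX.IsComplex X → HDX.IsPureDim X 3 → HDX.IsLocalSpectralExpander X 3 lam →
        0 < η → η < 1 →
        ∀ A : Finset (Finset V), A ⊆ HDX.facesCard X 3 →
          HDX.wt X 4 3 A ≤ η / 2 →
          HDX.wt X 4 1
              ((HDX.facesCard X 1).filter fun s => HDX.wt (HDX.link X s) 3 3 A ≤ η) ≥
            1 - C * (lam / η ^ 2) * HDX.wt X 4 3 A := by
  refine ⟨12, by norm_num, ?_⟩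
  intro V _ _ X lam η hX hP hE hη _ A _ hA
  exact HDX14.main X lam η hX hP hE hη A hA
end

section
/- Let X be a 3-dimensional simplicial complex and G a group. For any f ∈ C^1(X;G), if δ(f) is not locally minimal then there exist a vertex v ∈ X(0) and f' ∈ C^1(X;G) such that ‖f'f^{−1}‖ ≤ 2·‖{v}‖ and ‖δ(f')‖ < ‖δ(f)‖. -/
/- Common framework: weighted simplicial complexes, links, localizations,
   local spectral expansion, cochains, coboundaries, minimality, etc. -/

open Finset

open scoped Classical

namespace HDX

theorem mem_link_single {V : Type*} [Fintype V] [DecidableEq V]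
    (X : Finset (Finset V)) (v : V) (e : Finset V) :
    e ∈ link X {v} ↔ v ∉ e ∧ insert v e ∈ X := by
  classical
  simp only [link, localize, Finset.mem_image, Finset.mem_filter, Finset.singleton_subset_iff]
  constructor
  · rintro ⟨τ, ⟨h1, h2⟩, rfl⟩
    refine ⟨by simp, ?_⟩
    have : insert v (τ \ {v}) = τ := by ext x; by_cases hx : x = v <;> simp [hx, h2]
    convert h1
  · rintro ⟨h1, h2⟩
    refine ⟨insert v e, ⟨by convert h2, by simp⟩, ?_⟩
    ext x
    by_cases hx : x = v
    · simp [hx, h1]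
    · simp [hx]

theorem mem_supp2_iff {V : Type*} [Fintype V] [DecidableEq V] {G : Type*} [Group G]
    (X : Finset (Finset V)) (F : V → V → G) (hF : ∀ u v : V, F v u = (F u v)⁻¹)
    (v : V) (e : Finset V) (hv : v ∉ e) :
    insert v e ∈ supp2 X (d1 F) ↔ e ∈ supp1 (link X {v}) (locC1 (d1 F) v) := by
  have cyc : ∀ a b c, d1 F a b c ≠ 1 → d1 F b c a ≠ 1 := by
    intro a b c h h'
    apply h
    unfold d1 at *
    have : F a b = (F b c * F c a)⁻¹ := eq_inv_of_mul_eq_one_right h'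
    rw [this]; group
  simp only [supp2, supp1, facesCard, Finset.mem_filter, mem_link_single]
  constructor
  · rintro ⟨⟨h1, h2⟩, a, b, c, h3, hab, hac, hbc, h4⟩
    rw [Finset.card_insert_of_notMem hv] at h2
    refine ⟨⟨⟨hv, h1⟩, by omega⟩, ?_⟩
    have he : e = ({a, b, c} : Finset V).erase v := by
      rw [h3, Finset.erase_insert hv]
    have hm : v ∈ ({a, b, c} : Finset V) := by rw [h3]; simp
    simp only [Finset.mem_insert, Finset.mem_singleton] at hm
    rcases hm with rfl | rfl | rfl
    · refine ⟨b, c, ?_, hbc, h4⟩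
      rw [he]; ext x; simp; grind
    · refine ⟨c, a, ?_, hac.symm, cyc _ _ _ h4⟩
      rw [he]; ext x; simp; grind
    · refine ⟨a, b, ?_, hab, cyc _ _ _ (cyc _ _ _ h4)⟩
      rw [he]; ext x; simp; grind
  · rintro ⟨⟨⟨-, h1⟩, h2⟩, a, b, rfl, hab, h4⟩
    refine ⟨⟨h1, by rw [Finset.card_insert_of_notMem hv, h2]⟩, v, a, b, rfl, ?_, ?_, hab, h4⟩
    · rintro rfl; simp at hv
    · rintro rfl; simp at hv

theorem numer_split {V : Type*} [Fintype V] [DecidableEq V] {G : Type*} [Group G]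
    (X : Finset (Finset V)) (F : V → V → G) (hF : ∀ u v : V, F v u = (F u v)⁻¹) (v : V) :
    (∑ σ ∈ facesCard X 4, (((σ.powersetCard 3).filter (· ∈ supp2 X (d1 F))).card : ℝ)) =
    (∑ σ ∈ facesCard X 4,
      (((σ.powersetCard 3).filter (fun τ => v ∉ τ ∧ τ ∈ supp2 X (d1 F))).card : ℝ)) +
    ∑ σ ∈ facesCard (link X {v}) 3,
      (((σ.powersetCard 2).filter (· ∈ supp1 (link X {v}) (locC1 (d1 F) v))).card : ℝ) := by
  have key : (∑ σ ∈ facesCard (link X {v}) 3,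
      (((σ.powersetCard 2).filter (· ∈ supp1 (link X {v}) (locC1 (d1 F) v))).card : ℝ)) =
      ∑ σ ∈ facesCard X 4,
      (((σ.powersetCard 3).filter (fun τ => v ∈ τ ∧ τ ∈ supp2 X (d1 F))).card : ℝ) := by
    rw [← Finset.sum_filter_of_ne (p := fun σ => v ∈ σ) (s := facesCard X 4)]
    · refine Finset.sum_bij (fun σ _ => insert v σ) ?_ ?_ ?_ ?_
      · intro σ hσ
        simp only [facesCard, Finset.mem_filter, mem_link_single] at hσ ⊢
        refine ⟨⟨hσ.1.2, ?_⟩, by simp⟩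
        rw [Finset.card_insert_of_notMem hσ.1.1, hσ.2]
      · intro σ hσ σ' hσ' h
        simp only [facesCard, Finset.mem_filter, mem_link_single] at hσ hσ'
        rw [← Finset.erase_insert hσ.1.1, ← Finset.erase_insert hσ'.1.1, h]
      · intro σ hσ
        simp only [facesCard, Finset.mem_filter] at hσ
        refine ⟨σ.erase v, ?_, Finset.insert_erase hσ.2⟩
        simp only [facesCard, Finset.mem_filter, mem_link_single]
        refine ⟨⟨by simp, by rw [Finset.insert_erase hσ.2]; exact hσ.1.1⟩, ?_⟩
        rw [Finset.card_erase_of_mem hσ.2, hσ.1.2]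
      · intro σ hσ
        simp only [facesCard, Finset.mem_filter, mem_link_single] at hσ
        have hvσ := hσ.1.1
        congr 1
        refine Finset.card_bij (fun e _ => insert v e) ?_ ?_ ?_
        · intro e he
          simp only [Finset.mem_filter, Finset.mem_powersetCard] at he ⊢
          have hve : v ∉ e := fun h => hvσ (he.1.1 h)
          refine ⟨⟨Finset.insert_subset_insert _ he.1.1, ?_⟩, by simp, ?_⟩
          · rw [Finset.card_insert_of_notMem hve, he.1.2]
          · exact (mem_supp2_iff X F hF v e hve).2 he.2
        · intro e he e' he' h
          simp only [Finset.mem_filter, Finset.mem_powersetCard] at he he'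
          have hve : v ∉ e := fun h => hvσ (he.1.1 h)
          have hve' : v ∉ e' := fun h => hvσ (he'.1.1 h)
          rw [← Finset.erase_insert hve, ← Finset.erase_insert hve', h]
        · intro τ hτ
          simp only [Finset.mem_filter, Finset.mem_powersetCard] at hτ
          refine ⟨τ.erase v, ?_, Finset.insert_erase hτ.2.1⟩
          simp only [Finset.mem_filter, Finset.mem_powersetCard]
          refine ⟨⟨?_, ?_⟩, ?_⟩
          · rw [← Finset.erase_insert hvσ]; exact Finset.erase_subset_erase _ hτ.1.1
          · rw [Finset.card_erase_of_mem hτ.2.1, hτ.1.2]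
          · refine (mem_supp2_iff X F hF v _ (by simp)).1 ?_
            rw [Finset.insert_erase hτ.2.1]; exact hτ.2.2
    · intro σ _ hne
      by_contra hv
      apply hne
      rw [Nat.cast_eq_zero, Finset.card_eq_zero, Finset.filter_eq_empty_iff]
      intro τ hτ h
      exact hv ((Finset.mem_powersetCard.1 hτ).1 h.1)
  rw [key, ← Finset.sum_add_distrib]
  refine Finset.sum_congr rfl fun σ _ => ?_
  rw [← Nat.cast_add, ← Finset.card_union_of_disjoint]
  · congr 2
    ext τ
    simp only [Finset.mem_filter, Finset.mem_union]
    tauto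
  · rw [Finset.disjoint_left]
    intro τ h1 h2
    exact (Finset.mem_filter.1 h1).2.1 (Finset.mem_filter.1 h2).2.1

theorem edges_wt {V : Type*} [Fintype V] [DecidableEq V]
    (X : Finset (Finset V)) (A : Finset (Finset V)) (v : V) (hA : ∀ e ∈ A, v ∈ e) :
    wt X 4 2 A ≤ 2 * wt X 4 1 {({v} : Finset V)} := by
  unfold wt
  have h : (∑ σ ∈ facesCard X 4, (((σ.powersetCard 2).filter (· ∈ A)).card : ℝ)) ≤
      3 * ∑ σ ∈ facesCard X 4,
        (((σ.powersetCard 1).filter (· ∈ ({({v} : Finset V)} : Finset (Finset V)))).card : ℝ) := by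
    rw [Finset.mul_sum]
    refine Finset.sum_le_sum fun σ hσ => ?_
    have hc : σ.card = 4 := (Finset.mem_filter.1 hσ).2
    by_cases hv : v ∈ σ
    · have h1 : (σ.powersetCard 1).filter (· ∈ ({({v} : Finset V)} : Finset (Finset V)))
          = {{v}} := by
        ext τ
        simp only [Finset.mem_filter, Finset.mem_powersetCard, Finset.mem_singleton]
        constructor
        · exact fun h => h.2
        · rintro rfl; simp [hv]
      rw [h1]
      have h2 : (σ.powersetCard 2).filter (· ∈ A) ⊆ (σ.erase v).image (fun u => {v, u}) := by
        intro e he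
        simp only [Finset.mem_filter, Finset.mem_powersetCard] at he
        obtain ⟨⟨h3, h4⟩, h5⟩ := he
        have hve := hA e h5
        have : (e.erase v).card = 1 := by rw [Finset.card_erase_of_mem hve, h4]
        obtain ⟨u, hu⟩ := Finset.card_eq_one.1 this
        refine Finset.mem_image.2 ⟨u, ?_, ?_⟩
        · exact Finset.erase_subset_erase _ h3 (by rw [hu]; simp)
        · rw [← hu, Finset.insert_erase hve]
      have h3 := (Finset.card_le_card h2).trans Finset.card_image_le
      rw [Finset.card_erase_of_mem hv, hc] at h3
      have : (((σ.powersetCard 2).filter (· ∈ A)).card : ℝ) ≤ ((4 - 1 : ℕ) : ℝ) := by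
        exact_mod_cast h3
      norm_num at this ⊢
      exact this
    · have h1 : (σ.powersetCard 2).filter (· ∈ A) = ∅ := by
        rw [Finset.filter_eq_empty_iff]
        intro e he heA
        exact hv ((Finset.mem_powersetCard.1 he).1 (hA e heA))
      rw [h1]; simp
  have e1 : (Nat.choose 4 2 : ℝ) = 6 := by norm_num [Nat.choose]
  have e2 : (Nat.choose 4 1 : ℝ) = 4 := by norm_num
  rw [e1, e2]
  generalize (∑ σ ∈ facesCard X 4, (((σ.powersetCard 2).filter (· ∈ A)).card : ℝ)) = a at *
  generalize (∑ σ ∈ facesCard X 4,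
        (((σ.powersetCard 1).filter (· ∈ ({({v} : Finset V)} : Finset (Finset V)))).card : ℝ)) = b
        at *
  rcases Nat.eq_zero_or_pos (facesCard X 4).card with h0 | h0
  · simp [h0]
  · have : (0 : ℝ) < ((facesCard X 4).card : ℝ) := by exact_mod_cast h0
    have h6 : 2 * (b / (((facesCard X 4).card : ℝ) * 4)) =
        3 * b / (((facesCard X 4).card : ℝ) * 6) := by field_simp; ring
    rw [h6]
    gcongr

end HDX

theorem stmt17 {V : Type*} [Fintype V] [DecidableEq V] {G : Type*} [Group G]
    (X : Finset (Finset V)) (hX : HDX.IsComplex X) (hXd : HDX.IsPureDim X 3)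
    (f : V → V → G) (hf : HDX.IsC1 X f)
    (hnm : ¬HDX.LocallyMinimal2 X 4 (HDX.d1 f)) :
    ∃ v : V, ({v} : Finset V) ∈ X ∧ ∃ f' : V → V → G, HDX.IsC1 X f' ∧
      HDX.norm1 X 4 (fun u w => f' u w * (f u w)⁻¹) ≤
        2 * HDX.wt X 4 1 {({v} : Finset V)} ∧
      HDX.norm2 X 4 (HDX.d1 f') < HDX.norm2 X 4 (HDX.d1 f) := by
  unfold HDX.LocallyMinimal2 HDX.Minimal1 at hnm
  push Not at hnm
  obtain ⟨v, hv, h, hh, hlt⟩ := hnm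
  have hself : ∀ x, f x x = 1 := fun x => hf.2 x x (Or.inr rfl)
  have hhv : h v = 1 := hh v (by rw [HDX.mem_link_single]; simp)
  let k : V → V → G := fun a b => if a = v then h b else 1
  let f' : V → V → G := fun a b => k a b * f a b * (k b a)⁻¹
  have hanti : ∀ a b, f' b a = (f' a b)⁻¹ := by
    intro a b
    simp only [f', hf.1 a b]
    group
  have hk : ∀ a b, a ≠ v → k a b = 1 := fun a b hab => if_neg hab
  have hk2 : ∀ a b, ({a, b} : Finset V) ∉ X ∨ a = b → k a b = 1 := by
    intro a b hab
    by_cases hav : a = v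
    · subst hav
      simp only [k, if_true]
      apply hh
      rw [HDX.mem_link_single]
      rintro ⟨h1, h2⟩
      rcases hab with h3 | h3
      · exact h3 h2
      · subst h3; simp at h1
    · exact hk a b hav
  have hC1 : HDX.IsC1 X f' := by
    refine ⟨hanti, fun a b hab => ?_⟩
    have h1 := hk2 a b hab
    have h2 := hk2 b a (by rw [Finset.pair_comm]; exact hab.imp id Eq.symm)
    simp only [f', h1, h2, hf.2 a b hab]
    group
  have hoff : ∀ a b, a ≠ v → b ≠ v → f' a b = f a b := by
    intro a b ha hb
    simp [f', hk a b ha, hk b a hb]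
  refine ⟨v, hv, f', hC1, ?_, ?_⟩
  · apply HDX.edges_wt
    intro e he
    simp only [HDX.supp1, Finset.mem_filter] at he
    obtain ⟨-, a, b, rfl, hab, hne⟩ := he
    by_contra hve
    simp only [Finset.mem_insert, Finset.mem_singleton, not_or] at hve
    apply hne
    rw [hoff a b (Ne.symm hve.1) (Ne.symm hve.2)]
    group
  · have hloc : HDX.supp1 (HDX.link X {v}) (HDX.locC1 (HDX.d1 f') v) =
        HDX.supp1 (HDX.link X {v}) (HDX.act h (HDX.locC1 (HDX.d1 f) v)) := by
      have key : ∀ a b, a ≠ v → b ≠ v → HDX.locC1 (HDX.d1 f') v a b =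
          HDX.act h (HDX.locC1 (HDX.d1 f) v) a b := by
        intro a b ha hb
        simp only [HDX.locC1, HDX.act, HDX.d1, hoff a b ha hb]
        simp [f', k, ha, hb, mul_assoc]
      ext e
      simp only [HDX.supp1, HDX.facesCard, Finset.mem_filter, HDX.mem_link_single]
      refine and_congr_right fun he => exists_congr fun a => exists_congr fun b =>
        and_congr_right fun hab => and_congr_right fun _ => ?_
      have hve := he.1.1
      rw [← hab] at hve
      simp only [Finset.mem_insert, Finset.mem_singleton, not_or] at hve
      rw [key a b (Ne.symm hve.1) (Ne.symm hve.2)]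
    have hsame : ∀ τ : Finset V, (v ∉ τ ∧ τ ∈ HDX.supp2 X (HDX.d1 f')) ↔
        (v ∉ τ ∧ τ ∈ HDX.supp2 X (HDX.d1 f)) := by
      intro τ
      refine and_congr_right fun hvτ => ?_
      simp only [HDX.supp2, Finset.mem_filter]
      refine and_congr_right fun _ => exists_congr fun a => exists_congr fun b =>
        exists_congr fun c => and_congr_right fun habc => ?_
      rw [← habc] at hvτ
      simp only [Finset.mem_insert, Finset.mem_singleton, not_or] at hvτ
      obtain ⟨h1, h2, h3⟩ := hvτ
      simp only [HDX.d1, hoff a b (Ne.symm h1) (Ne.symm h2), hoff b c (Ne.symm h2) (Ne.symm h3),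
        hoff c a (Ne.symm h3) (Ne.symm h1)]
    have hpos : 0 < (HDX.facesCard X 4).card := by
      obtain ⟨τ, h1, -, h2⟩ := hXd.2.2 _ hv
      exact Finset.card_pos.2 ⟨τ, Finset.mem_filter.2 ⟨h1, h2⟩⟩
    have hpos' : (0 : ℝ) < ((HDX.facesCard X 4).card : ℝ) := by exact_mod_cast hpos
    unfold HDX.norm1 HDX.wt at hlt
    have hlt' := lt_of_not_ge fun hge => absurd hlt (not_lt_of_ge
      (div_le_div_of_nonneg_right hge (mul_nonneg (Nat.cast_nonneg _) (Nat.cast_nonneg _))))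
    unfold HDX.norm2 HDX.wt
    have h43 : (0 : ℝ) < (Nat.choose 4 3 : ℝ) := Nat.cast_pos.2 (by decide)
    apply div_lt_div_of_pos_right _ (mul_pos hpos' h43)
    rw [HDX.numer_split X f' hanti v, HDX.numer_split X f hf.1 v, hloc]
    simp only [hsame]
    exact add_lt_add_right hlt' _
end
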